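/- arXiv:1612.02383 — 2 statements merged into one kernel-verified Lean document; each statement's English description precedes it below -/
import Mathlib

section
/- Let E and F be real Hilbert spaces, let W : E → F be a bounded linear operator, and let b ∈ F lie in the closure of the range of W. For each α > 0, let h_α ∈ E be the unique solution of the normal equation (W* ∘ W + α·id_E) h_α = W* b. Then W h_α converges to b in F as α → 0⁺, i.e. ‖W h_α − b‖ → 0 along the filter α → 0 with α > 0. -/
open Filter Topology

/-- If `b` lies in the closure of the range of the bounded operator `W : E → F`
between real Hilbert spaces, and for each `α > 0` the element `h α` solves the
normal equation `(W*W + α id) (h α) = W* b`, then `W (h α) → b` as `α → 0⁺`. -/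
theorem tikhonov_convergence
    {E F : Type*} [NormedAddCommGroup E] [InnerProductSpace ℝ E] [CompleteSpace E]
    [NormedAddCommGroup F] [InnerProductSpace ℝ F] [CompleteSpace F]
    (W : E →L[ℝ] F) (b : F)
    (hb : b ∈ closure (Set.range W))
    (h : ℝ → E)
    (hh : ∀ α : ℝ, 0 < α →
      ((ContinuousLinearMap.adjoint W).comp W + α • ContinuousLinearMap.id ℝ E) (h α)
        = ContinuousLinearMap.adjoint W b) :
    Tendsto (fun α : ℝ => ‖W (h α) - b‖) (𝓝[>] 0) (𝓝 0) := by
  have key : ∀ α : ℝ, 0 < α → ∀ x : E,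
      ‖W (h α) - b‖ ^ 2 ≤ ‖W x - b‖ ^ 2 + α * ‖x‖ ^ 2 := by
    intro α hα x
    have h1 : inner ℝ (W (h α) - b) (W (x - h α)) + α * inner ℝ (h α) (x - h α) = 0 := by
      have h2 := congrArg (fun z => inner ℝ z (x - h α)) (hh α hα)
      simp only [ContinuousLinearMap.add_apply, ContinuousLinearMap.comp_apply,
        ContinuousLinearMap.smul_apply, ContinuousLinearMap.id_apply, inner_add_left,
        ContinuousLinearMap.adjoint_inner_left, real_inner_smul_left] at h2
      rw [inner_sub_left]
      linarith
    have h3 : W x - b = (W (h α) - b) + W (x - h α) := by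
      rw [map_sub]; abel
    have h4 : ‖x‖ ^ 2 = ‖h α‖ ^ 2 + 2 * inner ℝ (h α) (x - h α) + ‖x - h α‖ ^ 2 := by
      rw [← norm_add_sq_real]; congr 2; abel
    rw [h3, norm_add_sq_real, h4]
    have h5 : 0 ≤ α * ‖h α‖ ^ 2 := by positivity
    have h6 : 0 ≤ α * ‖x - h α‖ ^ 2 := by positivity
    have h7 : 0 ≤ ‖W (x - h α)‖ ^ 2 := by positivity
    nlinarith
  rw [Metric.tendsto_nhds]
  intro ε hε
  obtain ⟨_, ⟨x, rfl⟩, hx⟩ := Metric.mem_closure_iff.1 hb (ε / 2) (by positivity)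
  rw [dist_comm, dist_eq_norm] at hx
  have hd : 0 < ε ^ 2 / 2 / (‖x‖ ^ 2 + 1) := by positivity
  filter_upwards [Ioo_mem_nhdsGT hd] with α hα
  have hk := key α hα.1 x
  have h8 := (lt_div_iff₀ (by positivity)).1 hα.2
  rw [dist_zero_right, norm_norm]
  apply lt_of_pow_lt_pow_left₀ 2 hε.le
  have h9 : ‖W x - b‖ ^ 2 ≤ (ε / 2) ^ 2 := by gcongr
  nlinarith [hα.1, sq_nonneg ε]
end

section
/- (Domain of dependence for the one-dimensional wave equation.) Let t₀ > 0, s₀ ∈ ℝ, and let u : ℝ × ℝ → ℝ be twice continuously differentiable. Suppose that ∂²u/∂t²(τ,σ) − ∂²u/∂s²(τ,σ) = 0 for all (τ,σ) in the backward characteristic triangle Δ = {(τ,σ) : 0 ≤ τ ≤ t₀, |σ − s₀| ≤ t₀ − τ}, and that u(0,σ) = 0 and ∂u/∂t(0,σ) = 0 for every σ with |σ − s₀| ≤ t₀. Then u(t₀,s₀) = 0. -/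
/-- Domain of dependence for the one-dimensional wave equation: if `u` is `C²`,
solves `∂ₜ²u - ∂ₛ²u = 0` on the backward characteristic triangle of `(t₀, s₀)`,
and has vanishing Cauchy data on the base `{σ : |σ - s₀| ≤ t₀}` of the triangle,
then `u(t₀, s₀) = 0`. -/
theorem domain_of_dependence_one_dimensional_wave
    (t₀ s₀ : ℝ) (ht₀ : 0 < t₀)
    (u : ℝ × ℝ → ℝ) (hu : ContDiff ℝ 2 u)
    (hwave : ∀ τ σ : ℝ, 0 ≤ τ → τ ≤ t₀ → |σ - s₀| ≤ t₀ - τ →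
      iteratedDeriv 2 (fun t => u (t, σ)) τ - iteratedDeriv 2 (fun s => u (τ, s)) σ = 0)
    (hinit : ∀ σ : ℝ, |σ - s₀| ≤ t₀ → u (0, σ) = 0)
    (hinit' : ∀ σ : ℝ, |σ - s₀| ≤ t₀ → deriv (fun t => u (t, σ)) 0 = 0) :
    u (t₀, s₀) = 0 := by
  have hF : ContDiff ℝ 1 (fderiv ℝ u) := hu.fderiv_right (by norm_num)
  have du : ∀ p, HasFDerivAt u (fderiv ℝ u p) p := fun p =>
    ((hu.differentiable (by norm_num)) p).hasFDerivAt
  have dF : ∀ p, HasFDerivAt (fderiv ℝ u) (fderiv ℝ (fderiv ℝ u) p) p := fun p =>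
    ((hF.differentiable (by norm_num)) p).hasFDerivAt
  have hsym : ∀ p v w, fderiv ℝ (fderiv ℝ u) p v w = fderiv ℝ (fderiv ℝ u) p w v := by
    intro p v w
    exact (hu.contDiffAt.isSymmSndFDerivAt (by simp)) v w
  have lt : ∀ σ t : ℝ, HasDerivAt (fun t : ℝ => (t, σ)) ((1 : ℝ), (0 : ℝ)) t := fun σ t =>
    (hasDerivAt_id t).prodMk (hasDerivAt_const t σ)
  have ls : ∀ τ s : ℝ, HasDerivAt (fun s : ℝ => (τ, s)) ((0 : ℝ), (1 : ℝ)) s := fun τ s =>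
    (hasDerivAt_const s τ).prodMk (hasDerivAt_id s)
  have d1 : ∀ {γ : ℝ → ℝ × ℝ} {v : ℝ × ℝ} {t : ℝ}, HasDerivAt γ v t →
      HasDerivAt (fun x => u (γ x)) (fderiv ℝ u (γ t) v) t := by
    intro γ v t h
    exact (du (γ t)).comp_hasDerivAt t h
  have d2 : ∀ {γ : ℝ → ℝ × ℝ} {v : ℝ × ℝ} {t : ℝ} (w : ℝ × ℝ), HasDerivAt γ v t →
      HasDerivAt (fun x => fderiv ℝ u (γ x) w) (fderiv ℝ (fderiv ℝ u) (γ t) v w) t := by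
    intro γ v t w h
    have := (dF (γ t)).comp_hasDerivAt t h
    simpa using this.clm_apply (hasDerivAt_const t w)
  have itt : ∀ τ σ, iteratedDeriv 2 (fun t => u (t, σ)) τ
      = fderiv ℝ (fderiv ℝ u) (τ, σ) (1, 0) (1, 0) := by
    intro τ σ
    rw [iteratedDeriv_succ, iteratedDeriv_one]
    rw [show deriv (fun t => u (t, σ)) = fun t => fderiv ℝ u (t, σ) (1, 0) from
      funext fun t => (d1 (lt σ t)).deriv]
    exact (d2 _ (lt σ τ)).deriv
  have iss : ∀ τ σ, iteratedDeriv 2 (fun s => u (τ, s)) σ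
      = fderiv ℝ (fderiv ℝ u) (τ, σ) (0, 1) (0, 1) := by
    intro τ σ
    rw [iteratedDeriv_succ, iteratedDeriv_one]
    rw [show deriv (fun s => u (τ, s)) = fun s => fderiv ℝ u (τ, s) (0, 1) from
      funext fun s => (d1 (ls τ s)).deriv]
    exact (d2 _ (ls τ σ)).deriv
  have e1 : ((1 : ℝ), (1 : ℝ)) = (1, 0) + (0, 1) := by simp
  have e2 : ((1 : ℝ), (-1 : ℝ)) = (1, 0) - (0, 1) := by simp
  -- the mixed characteristic derivative vanishes on the triangle
  have hmix : ∀ τ σ : ℝ, 0 ≤ τ → τ ≤ t₀ → |σ - s₀| ≤ t₀ - τ →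
      fderiv ℝ (fderiv ℝ u) (τ, σ) (1, 1) (1, -1) = 0 := by
    intro τ σ h0 h1 h2
    have := hwave τ σ h0 h1 h2
    rw [itt, iss] at this
    rw [e1, e2]
    simp only [map_add, map_sub, add_apply]
    have := hsym (τ, σ) (1, 0) (0, 1)
    linarith
  -- data on the base
  have hbase : ∀ σ : ℝ, |σ - s₀| ≤ t₀ → fderiv ℝ u (0, σ) (1, -1) = 0 := by
    intro σ hσ
    have hP : fderiv ℝ u (0, σ) (1, 0) = 0 := by
      exact (d1 (lt σ 0)).deriv.symm.trans (hinit' σ hσ)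
    have hQ : fderiv ℝ u (0, σ) (0, 1) = 0 := by
      have hm : ∀ x, x ∈ Set.Icc (s₀ - t₀) (s₀ + t₀) ↔ |x - s₀| ≤ t₀ := by
        intro x
        rw [abs_le, Set.mem_Icc]
        constructor <;> rintro ⟨a, b⟩ <;> constructor <;> linarith
      have hud := (uniqueDiffOn_Icc (show s₀ - t₀ < s₀ + t₀ by linarith)) σ ((hm σ).2 hσ)
      have h1 := (d1 (ls 0 σ)).hasDerivWithinAt (s := Set.Icc (s₀ - t₀) (s₀ + t₀))
      have h2 : HasDerivWithinAt (fun s => u (0, s)) 0 (Set.Icc (s₀ - t₀) (s₀ + t₀)) σ :=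
        (hasDerivWithinAt_const σ _ (0 : ℝ)).congr (fun x hx => hinit x ((hm x).1 hx))
          (hinit σ hσ)
      exact hud.eq_deriv _ h1 h2
    rw [e2, map_sub, hP, hQ, sub_zero]
  have hedge : ∀ r ∈ Set.Icc 0 t₀, fderiv ℝ u (r, s₀ + t₀ - r) (1, -1) = 0 := by
    rintro r ⟨hr0, hr1⟩
    have hl : ∀ q, HasDerivAt (fun q : ℝ => (q, s₀ + t₀ - 2 * r + q)) ((1 : ℝ), (1 : ℝ)) q :=
      fun q => (hasDerivAt_id q).prodMk ((hasDerivAt_id q).const_add _)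
    have hd := fun q => d2 (1, -1) (hl q)
    have := constant_of_has_deriv_right_zero (a := 0) (b := r)
      (f := fun q => fderiv ℝ u (q, s₀ + t₀ - 2 * r + q) (1, -1))
      (fun q _ => (hd q).continuousAt.continuousWithinAt)
      (fun q hq => by
        have h := (hd q).hasDerivWithinAt (s := Set.Ici q)
        rwa [hmix q _ hq.1 (hq.2.le.trans hr1) (by
          have := hq.1
          have := hq.2
          rw [abs_le]; constructor <;> linarith)] at h) r ⟨hr0, le_rfl⟩
    rw [show s₀ + t₀ - 2 * r + r = s₀ + t₀ - r by ring] at this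
    rw [this, add_zero]
    apply hbase
    rw [abs_le]; constructor <;> linarith
  have hl : ∀ q, HasDerivAt (fun q : ℝ => (q, s₀ + t₀ - q)) ((1 : ℝ), (-1 : ℝ)) q :=
    fun q => (hasDerivAt_id q).prodMk ((hasDerivAt_id q).const_sub _)
  have := constant_of_has_deriv_right_zero (a := 0) (b := t₀)
      (f := fun q => u (q, s₀ + t₀ - q))
      (fun q _ => (d1 (hl q)).continuousAt.continuousWithinAt)
      (fun q hq => by
        have h := (d1 (hl q)).hasDerivWithinAt (s := Set.Ici q)
        rwa [hedge q ⟨hq.1, hq.2.le⟩] at h) t₀ ⟨ht₀.le, le_rfl⟩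
  simp only [add_sub_cancel_right, sub_zero] at this
  rw [this]
  apply hinit
  rw [add_sub_cancel_left, abs_of_pos ht₀]
end
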